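/- arXiv:2409.12779 — 2 statements merged into one kernel-verified Lean document; each statement's English description precedes it below -/
import Mathlib

section
/- For all integers n, m with 0 < n < p and 0 < m < q, the trace of S_p^n U_q^m is strictly negative. -/
open Matrix Real

/-- `SL(2,ℝ)`. -/
abbrev SL2R := Matrix.SpecialLinearGroup (Fin 2) ℝ

/-- The generator `S_p = [[0,-1],[1,2cos(π/p)]]` of the triangle group. -/
noncomputable def Sp (p : ℕ) : SL2R :=
  ⟨!![0, -1; 1, 2 * Real.cos (π / p)], by simp [Matrix.det_fin_two_of]⟩

/-- The generator `U_q = [[2cos(π/q),-1],[1,0]]` of the triangle group. -/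
noncomputable def Uq (q : ℕ) : SL2R :=
  ⟨!![2 * Real.cos (π / q), -1; 1, 0], by simp [Matrix.det_fin_two_of]⟩

/-- The triangle group `Γ_{p,q}`, the subgroup of `SL(2,ℝ)` generated by `S_p` and `U_q`. -/
noncomputable def TriangleGroup (p q : ℕ) : Subgroup SL2R :=
  Subgroup.closure {Sp p, Uq q}

/-- The sign `sgn(g)`: the sign of the lower-left entry if nonzero, otherwise
the sign of the lower-right entry. -/
noncomputable def sgn (g : SL2R) : ℝ :=
  if (g : Matrix (Fin 2) (Fin 2) ℝ) 1 0 ≠ 0 then Real.sign ((g : Matrix (Fin 2) (Fin 2) ℝ) 1 0)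
  else Real.sign ((g : Matrix (Fin 2) (Fin 2) ℝ) 1 1)

/-- Asai's cocycle `W(g₁,g₂) = (sgn g₁ + sgn g₂ - sgn(g₁g₂) - sgn g₁ · sgn g₂ · sgn(g₁g₂))/4`. -/
noncomputable def W (g₁ g₂ : SL2R) : ℝ :=
  (sgn g₁ + sgn g₂ - sgn (g₁ * g₂) - sgn g₁ * sgn g₂ * sgn (g₁ * g₂)) / 4

/-- The Chebyshev-like polynomials `C_n`, with `C_0 = 0`, `C_1 = 1` and
`C_{n+1}(x) = 2x C_n(x) - C_{n-1}(x)`, evaluated at `x`; namely `C_n = U_{n-1}`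
with `U` the Chebyshev polynomial of the second kind. -/
noncomputable def Cheb (n : ℤ) (x : ℝ) : ℝ :=
  (Polynomial.Chebyshev.U ℝ (n - 1)).eval x

theorem Sp_pow_entries (p k : ℕ) :
    Real.sin (π / p) • ((Sp p ^ k : SL2R) : Matrix (Fin 2) (Fin 2) ℝ) =
      !![-Real.sin (((k : ℝ) - 1) * (π / p)), -Real.sin (k * (π / p));
         Real.sin (k * (π / p)), Real.sin (((k : ℝ) + 1) * (π / p))] := by
  induction k with
  | zero =>
    ext i j
    fin_cases i <;> fin_cases j <;> simp
  | succ k ih =>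
    rw [pow_succ, Matrix.SpecialLinearGroup.coe_mul, ← Matrix.smul_mul, ih]
    have e1 : Real.sin (((k : ℝ) + 1 - 1) * (π / p)) = Real.sin (k * (π / p)) := by
      congr 1; ring
    have e2 : Real.sin (((k : ℝ) + 1) * (π / p)) =
        2 * Real.cos (π / p) * Real.sin (k * (π / p)) - Real.sin (((k : ℝ) - 1) * (π / p)) := by
      rw [add_mul, sub_mul, one_mul, Real.sin_add, Real.sin_sub]; ring
    have e3 : Real.sin (((k : ℝ) + 1 + 1) * (π / p)) =
        2 * Real.cos (π / p) * Real.sin (((k : ℝ) + 1) * (π / p)) - Real.sin (k * (π / p)) := by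
      have : (k : ℝ) * (π / p) = ((k : ℝ) + 1) * (π / p) - π / p := by ring
      rw [this, add_mul ((k : ℝ) + 1), one_mul, Real.sin_add, Real.sin_sub]; ring
    ext i j
    fin_cases i <;> fin_cases j <;>
      simp [Sp, Matrix.mul_apply, Fin.sum_univ_two] <;> linarith

theorem Uq_pow_entries (p k : ℕ) :
    Real.sin (π / p) • ((Uq p ^ k : SL2R) : Matrix (Fin 2) (Fin 2) ℝ) =
      !![Real.sin (((k : ℝ) + 1) * (π / p)), -Real.sin (k * (π / p));
         Real.sin (k * (π / p)), -Real.sin (((k : ℝ) - 1) * (π / p))] := by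
  induction k with
  | zero =>
    ext i j
    fin_cases i <;> fin_cases j <;> simp
  | succ k ih =>
    rw [pow_succ, Matrix.SpecialLinearGroup.coe_mul, ← Matrix.smul_mul, ih]
    have e1 : Real.sin (((k : ℝ) + 1 - 1) * (π / p)) = Real.sin (k * (π / p)) := by
      congr 1; ring
    have e2 : Real.sin (((k : ℝ) + 1) * (π / p)) =
        2 * Real.cos (π / p) * Real.sin (k * (π / p)) - Real.sin (((k : ℝ) - 1) * (π / p)) := by
      rw [add_mul, sub_mul, one_mul, Real.sin_add, Real.sin_sub]; ring
    have e3 : Real.sin (((k : ℝ) + 1 + 1) * (π / p)) =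
        2 * Real.cos (π / p) * Real.sin (((k : ℝ) + 1) * (π / p)) - Real.sin (k * (π / p)) := by
      have : (k : ℝ) * (π / p) = ((k : ℝ) + 1) * (π / p) - π / p := by ring
      rw [this, add_mul ((k : ℝ) + 1), one_mul, Real.sin_add, Real.sin_sub]; ring
    ext i j
    fin_cases i <;> fin_cases j <;>
      simp [Uq, Matrix.mul_apply, Fin.sum_univ_two] <;> linarith

theorem sin_mul_nonneg_aux (p : ℕ) (hp : 0 < p) (x : ℝ) (h0 : 0 ≤ x) (h1 : x ≤ p) :
    0 ≤ Real.sin (x * (π / p)) := by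
  have hp' : (0 : ℝ) < p := by exact_mod_cast hp
  apply Real.sin_nonneg_of_nonneg_of_le_pi
  · positivity
  · rw [← mul_div_assoc, div_le_iff₀ hp', mul_comm]
    exact mul_le_mul_of_nonneg_left h1 Real.pi_pos.le

theorem sin_mul_pos_aux (p : ℕ) (hp : 0 < p) (x : ℝ) (h0 : 0 < x) (h1 : x < p) :
    0 < Real.sin (x * (π / p)) := by
  have hp' : (0 : ℝ) < p := by exact_mod_cast hp
  apply Real.sin_pos_of_pos_of_lt_pi
  · positivity
  · rw [← mul_div_assoc, div_lt_iff₀ hp', mul_comm]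
    exact mul_lt_mul_of_pos_left h1 Real.pi_pos

/-- The trace of `S_p^n U_q^m` is strictly negative for `0 < n < p` and `0 < m < q`. -/
theorem trace_Sp_Uq_neg (p q : ℕ) (hp : 2 ≤ p) (hpq : p < q) (hco : Nat.Coprime p q)
    (n m : ℤ) (hn0 : 0 < n) (hnp : n < p) (hm0 : 0 < m) (hmq : m < q) :
    Matrix.trace ((Sp p ^ n * Uq q ^ m : SL2R) : Matrix (Fin 2) (Fin 2) ℝ) < 0 := by
  lift n to ℕ using hn0.le
  lift m to ℕ using hm0.le
  rw [zpow_natCast, zpow_natCast, Matrix.SpecialLinearGroup.coe_mul]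
  have hn1 : (1 : ℝ) ≤ n := by exact_mod_cast hn0
  have hm1 : (1 : ℝ) ≤ m := by exact_mod_cast hm0
  have hn2 : (n : ℝ) + 1 ≤ p := by exact_mod_cast hnp
  have hm2 : (m : ℝ) + 1 ≤ q := by exact_mod_cast hmq
  have hp0 : 0 < p := by omega
  have hq0 : 0 < q := by omega
  have sp := sin_mul_pos_aux p hp0 1 one_pos (by linarith)
  have sq := sin_mul_pos_aux q hq0 1 one_pos (by linarith)
  rw [one_mul] at sp sq
  have a1 := sin_mul_nonneg_aux p hp0 ((n : ℝ) - 1) (by linarith) (by linarith)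
  have a2 := sin_mul_pos_aux p hp0 (n : ℝ) (by linarith) (by linarith)
  have a3 := sin_mul_nonneg_aux p hp0 ((n : ℝ) + 1) (by linarith) (by linarith)
  have b1 := sin_mul_nonneg_aux q hq0 ((m : ℝ) - 1) (by linarith) (by linarith)
  have b2 := sin_mul_pos_aux q hq0 (m : ℝ) (by linarith) (by linarith)
  have b3 := sin_mul_nonneg_aux q hq0 ((m : ℝ) + 1) (by linarith) (by linarith)
  have key : (Real.sin (π / p) * Real.sin (π / q)) *
      Matrix.trace (((Sp p ^ n : SL2R) : Matrix (Fin 2) (Fin 2) ℝ) *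
        ((Uq q ^ m : SL2R) : Matrix (Fin 2) (Fin 2) ℝ)) < 0 := by
    rw [← smul_eq_mul, ← Matrix.trace_smul, ← smul_mul_smul_comm, Sp_pow_entries,
      Uq_pow_entries]
    simp only [Matrix.trace_fin_two, Matrix.mul_apply, Fin.sum_univ_two, Matrix.of_apply,
      Matrix.cons_val', Matrix.cons_val_zero, Matrix.cons_val_one, Matrix.cons_val_fin_one]
    have := mul_nonneg a1 b3
    have := mul_pos a2 b2
    have := mul_nonneg a3 b1
    linarith
  exact (pos_iff_neg_of_mul_neg key).1 (mul_pos sp sq)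
end

section
/- Suppose ψ : Γ_{p,q} → ℤ satisfies ψ(γ₁γ₂) = ψ(γ₁) + ψ(γ₂) + 2pq·W(γ₁, γ₂) for all γ₁, γ₂ ∈ Γ_{p,q}, and that the resulting Rademacher symbol Ψ_{p,q} is invariant under conjugation and under negation, i.e., Ψ_{p,q}(γ) = Ψ_{p,q}(-γ) = Ψ_{p,q}(g⁻¹γg) for all γ, g ∈ Γ_{p,q}. Let r ≥ 1 and let γ ∈ Γ_{p,q} be conjugate in Γ_{p,q} to ε·S_p^{n₁} U_q^{m₁} ⋯ S_p^{n_r} U_q^{m_r} for some sign ε ∈ {+1, -1} and integers 0 < n_j < p, 0 < m_j < q (1 ≤ j ≤ r). Then Ψ_{p,q}(γ) = Σ_{j=1}^r (pq - q·n_j - p·m_j). -/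
open Matrix Real

/-- The Rademacher symbol `Ψ_{p,q}(γ) = ψ(γ) + (pq/2)·sgn(γ)·(1 - sign(tr γ))` attached
to a function `ψ : Γ_{p,q} → ℤ`. -/
noncomputable def Psi (p q : ℕ) (ψ : TriangleGroup p q → ℤ) (γ : TriangleGroup p q) : ℝ :=
  (ψ γ : ℝ) + (p * q : ℝ) / 2 * sgn (γ : SL2R) *
    (1 - Real.sign (Matrix.trace ((γ : SL2R) : Matrix (Fin 2) (Fin 2) ℝ)))

/-- Sign pattern closed under products. -/
def GoodM (g : SL2R) : Prop :=
  0 < g.1 0 0 ∧ 0 < g.1 1 1 ∧ g.1 0 1 ≤ 0 ∧ g.1 1 0 ≤ 0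

lemma GoodM.one : GoodM 1 := by
  simp [GoodM]

lemma GoodM.mul {g h : SL2R} (hg : GoodM g) (hh : GoodM h) : GoodM (g * h) := by
  obtain ⟨a, b, c, d⟩ := hg
  obtain ⟨a', b', c', d'⟩ := hh
  simp only [GoodM, Matrix.SpecialLinearGroup.coe_mul, Matrix.mul_apply, Fin.sum_univ_two]
  refine ⟨?_, ?_, ?_, ?_⟩
  · have := mul_pos a a'
    have := mul_nonneg_of_nonpos_of_nonpos c d'
    linarith
  · have := mul_pos b b'
    have := mul_nonneg_of_nonpos_of_nonpos d c'
    linarith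
  · have := mul_nonpos_of_nonneg_of_nonpos a.le c'
    have := mul_nonpos_of_nonpos_of_nonneg c b'.le
    linarith
  · have := mul_nonpos_of_nonneg_of_nonpos b.le d'
    have := mul_nonpos_of_nonpos_of_nonneg d a'.le
    linarith

lemma sgn_of_pos {g : SL2R} (h : 0 < g.1 1 0) : sgn g = 1 := by
  unfold sgn
  rw [if_pos h.ne', Real.sign_of_pos h]

lemma sgn_of_neg {g : SL2R} (h : g.1 1 0 < 0) : sgn g = -1 := by
  unfold sgn
  rw [if_pos h.ne, Real.sign_of_neg h]

lemma sgn_zero_pos {g : SL2R} (h : g.1 1 0 = 0) (h' : 0 < g.1 1 1) : sgn g = 1 := by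
  unfold sgn
  rw [if_neg (not_not.mpr h), Real.sign_of_pos h']

lemma sgn_zero_neg {g : SL2R} (h : g.1 1 0 = 0) (h' : g.1 1 1 < 0) : sgn g = -1 := by
  unfold sgn
  rw [if_neg (not_not.mpr h), Real.sign_of_neg h']

lemma sgn_one' : sgn 1 = 1 := sgn_zero_pos (by simp) (by simp)

lemma sgn_neg_one' : sgn (-1) = -1 := sgn_zero_neg (by simp) (by simp)

lemma GoodM.W {g h : SL2R} (hg : GoodM g) (hh : GoodM h) : W g h = 0 := by
  have hgh := hg.mul hh
  have e : (g * h).1 1 0 = g.1 1 0 * h.1 0 0 + g.1 1 1 * h.1 1 0 := by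
    simp only [Matrix.SpecialLinearGroup.coe_mul, Matrix.mul_apply, Fin.sum_univ_two]
  obtain ⟨a, b, c, d⟩ := hg
  obtain ⟨a', b', c', d'⟩ := hh
  unfold _root_.W
  rcases d.eq_or_lt with d | d
  · rcases d'.eq_or_lt with d' | d'
    · rw [sgn_zero_pos d b, sgn_zero_pos d' b', sgn_zero_pos (by rw [e, d, d']; ring) hgh.2.1]
      norm_num
    · rw [sgn_zero_pos d b, sgn_of_neg d', sgn_of_neg (by rw [e]; nlinarith)]
      norm_num
  · have := mul_neg_of_neg_of_pos d a'
    have := mul_nonpos_of_nonneg_of_nonpos b.le d'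
    rw [sgn_of_neg d, sgn_of_neg (g := g * h) (by rw [e]; linarith)]
    norm_num

lemma sin_rec (θ x : ℝ) : sin ((x + 1) * θ) = 2 * cos θ * sin (x * θ) - sin ((x - 1) * θ) := by
  have h1 : (x + 1) * θ = x * θ + θ := by ring
  have h2 : (x - 1) * θ = x * θ - θ := by ring
  rw [h1, h2, sin_add, sin_sub]; ring

lemma Sp_pow (p : ℕ) (hs : sin (π / p) ≠ 0) (n : ℕ) :
    ((Sp p ^ n : SL2R) : Matrix (Fin 2) (Fin 2) ℝ) =
      !![-(sin (((n : ℝ) - 1) * (π / p)) / sin (π / p)), -(sin (n * (π / p)) / sin (π / p));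
        sin (n * (π / p)) / sin (π / p), sin (((n : ℝ) + 1) * (π / p)) / sin (π / p)] := by
  induction n with
  | zero =>
    ext i j
    fin_cases i <;> fin_cases j <;> simp [neg_div, hs]
  | succ n ih =>
    rw [pow_succ, Matrix.SpecialLinearGroup.coe_mul, ih]
    have r1 := sin_rec (π / p) n
    have r2 := sin_rec (π / p) (n + 1)
    rw [add_sub_cancel_right] at r2
    ext i j
    fin_cases i <;> fin_cases j <;>
      simp [Sp, Matrix.mul_apply, Fin.sum_univ_two, r1, r2] <;> field_simp <;> ring

lemma Uq_pow (p : ℕ) (hs : sin (π / p) ≠ 0) (n : ℕ) :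
    ((Uq p ^ n : SL2R) : Matrix (Fin 2) (Fin 2) ℝ) =
      !![sin (((n : ℝ) + 1) * (π / p)) / sin (π / p), -(sin (n * (π / p)) / sin (π / p));
        sin (n * (π / p)) / sin (π / p), -(sin (((n : ℝ) - 1) * (π / p)) / sin (π / p))] := by
  induction n with
  | zero =>
    ext i j
    fin_cases i <;> fin_cases j <;> simp [neg_div, hs]
  | succ n ih =>
    rw [pow_succ, Matrix.SpecialLinearGroup.coe_mul, ih]
    have r1 := sin_rec (π / p) n
    have r2 := sin_rec (π / p) (n + 1)
    rw [add_sub_cancel_right] at r2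
    ext i j
    fin_cases i <;> fin_cases j <;>
      simp [Uq, Matrix.mul_apply, Fin.sum_univ_two, r1, r2] <;> field_simp <;> ring

lemma sin_pos_frac (p : ℕ) (x : ℝ) (h0 : 0 < x) (h1 : x < p) : 0 < sin (x * (π / p)) := by
  have hp : (0 : ℝ) < p := h0.trans h1
  apply sin_pos_of_pos_of_lt_pi
  · have := pi_pos
    positivity
  · rw [mul_div_assoc', div_lt_iff₀ hp, mul_comm]
    exact mul_lt_mul_of_pos_left h1 pi_pos

lemma sin_nonneg_frac (p : ℕ) (x : ℝ) (h0 : 0 ≤ x) (h1 : x ≤ p) : 0 ≤ sin (x * (π / p)) := by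
  rcases h0.eq_or_lt with h | h
  · simp [← h]
  rcases h1.eq_or_lt with h' | h'
  · have : (p : ℝ) ≠ 0 := by rw [← h']; exact h.ne'
    rw [h', mul_div_cancel₀ _ this, sin_pi]
  · exact (sin_pos_frac p x h h').le

lemma sin_base (p : ℕ) (hp : 2 ≤ p) : 0 < sin (π / p) := by
  have h : (2 : ℝ) ≤ p := by exact_mod_cast hp
  simpa using sin_pos_frac p 1 one_pos (by linarith)

lemma sin_last (p : ℕ) (hp : 2 ≤ p) :
    sin (p * (π / p)) = 0 ∧ sin (((p : ℝ) + 1) * (π / p)) = - sin (π / p) ∧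
      sin (((p : ℝ) - 1) * (π / p)) = sin (π / p) := by
  have h : (p : ℝ) ≠ 0 := by positivity
  have e : (p : ℝ) * (π / p) = π := mul_div_cancel₀ _ h
  refine ⟨by rw [e, sin_pi], ?_, ?_⟩
  · rw [add_mul, e, one_mul, add_comm, sin_add_pi]
  · rw [sub_mul, e, one_mul, sin_pi_sub]

lemma Sp_pow_p (p : ℕ) (hp : 2 ≤ p) : Sp p ^ p = -1 := by
  have hs := (sin_base p hp).ne'
  obtain ⟨h1, h2, h3⟩ := sin_last p hp
  apply Subtype.ext
  rw [Sp_pow p hs, h1, h2, h3]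
  ext i j
  fin_cases i <;> fin_cases j <;> simp [neg_div, hs]

lemma Uq_pow_p (p : ℕ) (hp : 2 ≤ p) : Uq p ^ p = -1 := by
  have hs := (sin_base p hp).ne'
  obtain ⟨h1, h2, h3⟩ := sin_last p hp
  apply Subtype.ext
  rw [Uq_pow p hs, h1, h2, h3]
  ext i j
  fin_cases i <;> fin_cases j <;> simp [neg_div, hs]

lemma sgn_Sp_pow (p : ℕ) (hp : 2 ≤ p) (n : ℕ) (h0 : 0 < n) (h1 : n < p) : sgn (Sp p ^ n) = 1 := by
  have hs := sin_base p hp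
  apply sgn_of_pos
  rw [Sp_pow p hs.ne']
  simpa using div_pos (sin_pos_frac p n (by exact_mod_cast h0) (by exact_mod_cast h1)) hs

lemma sgn_Uq_pow (p : ℕ) (hp : 2 ≤ p) (n : ℕ) (h0 : 0 < n) (h1 : n < p) : sgn (Uq p ^ n) = 1 := by
  have hs := sin_base p hp
  apply sgn_of_pos
  rw [Uq_pow p hs.ne']
  simpa using div_pos (sin_pos_frac p n (by exact_mod_cast h0) (by exact_mod_cast h1)) hs

lemma good_block (p q : ℕ) (hp : 2 ≤ p) (hq : 2 ≤ q) (n m : ℕ) (h0 : 0 < n) (h1 : n < p)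
    (h2 : 0 < m) (h3 : m < q) : GoodM (-(Sp p ^ n * Uq q ^ m)) := by
  have hs := sin_base p hp
  have ht := sin_base q hq
  have h0' : (1 : ℝ) ≤ n := by exact_mod_cast h0
  have h1' : (n : ℝ) + 1 ≤ p := by exact_mod_cast h1
  have h2' : (1 : ℝ) ≤ m := by exact_mod_cast h2
  have h3' : (m : ℝ) + 1 ≤ q := by exact_mod_cast h3
  have a1 := div_pos (sin_pos_frac p n (by linarith) (by linarith)) hs
  have a2 := div_nonneg (sin_nonneg_frac p (n - 1) (by linarith) (by linarith)) hs.le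
  have a3 := div_nonneg (sin_nonneg_frac p (n + 1) (by linarith) (by linarith)) hs.le
  have b1 := div_pos (sin_pos_frac q m (by linarith) (by linarith)) ht
  have b2 := div_nonneg (sin_nonneg_frac q (m - 1) (by linarith) (by linarith)) ht.le
  have b3 := div_nonneg (sin_nonneg_frac q (m + 1) (by linarith) (by linarith)) ht.le
  have c1 := mul_pos a1 b1
  have c2 := mul_nonneg a2 b3
  have c3 := mul_nonneg a3 b2
  have c4 := mul_nonneg a1.le b3
  have c5 := mul_nonneg a1.le b2
  have c6 := mul_nonneg a2 b1.le
  have c7 := mul_nonneg a3 b1.le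
  have e : (-(Sp p ^ n * Uq q ^ m) : SL2R).1 =
    -((Sp p ^ n : SL2R).1 * (Uq q ^ m : SL2R).1) := by simp
  unfold GoodM
  rw [e, Sp_pow p hs.ne', Uq_pow q ht.ne']
  simp only [Matrix.neg_apply, Matrix.mul_apply, Fin.sum_univ_two, Matrix.of_apply,
    Matrix.cons_val_zero, Matrix.cons_val_one, Matrix.cons_val', Matrix.cons_val_fin_one]
  refine ⟨?_, ?_, ?_, ?_⟩ <;> linarith

section
variable {p q : ℕ} {ψ : TriangleGroup p q → ℤ}

lemma psi_one (hψ : ∀ γ₁ γ₂ : TriangleGroup p q,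
      (ψ (γ₁ * γ₂) : ℝ) = ψ γ₁ + ψ γ₂ + 2 * p * q * W (γ₁ : SL2R) (γ₂ : SL2R)) :
    (ψ 1 : ℝ) = 0 := by
  have h := hψ 1 1
  simp only [mul_one, OneMemClass.coe_one, W, sgn_one'] at h
  linarith

lemma psi_neg_one (hψ : ∀ γ₁ γ₂ : TriangleGroup p q,
      (ψ (γ₁ * γ₂) : ℝ) = ψ γ₁ + ψ γ₂ + 2 * p * q * W (γ₁ : SL2R) (γ₂ : SL2R))
    (z : TriangleGroup p q) (hz : (z : SL2R) = -1) :
    (ψ z : ℝ) = p * q := by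
  have h := hψ z z
  have e : z * z = 1 := Subtype.ext (by simp [hz])
  rw [e, psi_one hψ, hz, W] at h
  simp only [mul_neg, mul_one, neg_neg, sgn_one', sgn_neg_one'] at h
  linarith

lemma psi_pow (hψ : ∀ γ₁ γ₂ : TriangleGroup p q,
      (ψ (γ₁ * γ₂) : ℝ) = ψ γ₁ + ψ γ₂ + 2 * p * q * W (γ₁ : SL2R) (γ₂ : SL2R))
    (k : ℕ) (hk : 2 ≤ k) (s : TriangleGroup p q) (hs : (s : SL2R) ^ k = -1)
    (hsg : ∀ n : ℕ, 0 < n → n < k → sgn ((s : SL2R) ^ n) = 1) :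
    (k : ℝ) * ψ s = - (p * q) ∧ ∀ n : ℕ, n < k → (ψ (s ^ n) : ℝ) = n * ψ s := by
  have s1 : sgn (s : SL2R) = 1 := by simpa using hsg 1 one_pos (by omega)
  have key : ∀ n : ℕ, n < k → (ψ (s ^ n) : ℝ) = n * ψ s := by
    intro n
    induction n with
    | zero => intro _; simp [psi_one hψ]
    | succ n ih =>
      intro hn
      have i := ih (by omega)
      rcases Nat.eq_zero_or_pos n with h0 | h0
      · subst h0; simp
      have e : (s : SL2R) ^ n * s = (s : SL2R) ^ (n + 1) := (pow_succ _ _).symm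
      rw [pow_succ, hψ, i, W, SubmonoidClass.coe_pow, e, hsg n h0 (by omega), s1,
        hsg (n + 1) (by omega) hn]
      push_cast
      ring
  refine ⟨?_, key⟩
  obtain ⟨l, rfl⟩ : ∃ l, k = l + 1 := ⟨k - 1, by omega⟩
  have e : (s : SL2R) ^ l * s = -1 := by rw [← hs, pow_succ]
  have h := hψ (s ^ l) s
  rw [psi_neg_one hψ (s ^ l * s) (by simpa using e), key l (by omega), W, SubmonoidClass.coe_pow, e,
    hsg l (by omega) (by omega), s1, sgn_neg_one'] at h
  push_cast
  linarith

lemma Psi_good (g : TriangleGroup p q) (hg : GoodM g) : Psi p q ψ g = ψ g := by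
  have : 0 < Matrix.trace ((g : SL2R) : Matrix (Fin 2) (Fin 2) ℝ) := by
    rw [Matrix.trace_fin_two]
    exact add_pos hg.1 hg.2.1
  rw [Psi, Real.sign_of_pos this]
  ring

end

/-- Main theorem: if `γ ∈ Γ_{p,q}` is conjugate to `±S_p^{n₁}U_q^{m₁} ⋯ S_p^{n_r}U_q^{m_r}`
with `0 < n_j < p` and `0 < m_j < q`, then `Ψ_{p,q}(γ) = Σ_j (pq - q n_j - p m_j)`. -/
theorem Psi_explicit (p q : ℕ) (hp : 2 ≤ p) (hpq : p < q) (hco : Nat.Coprime p q)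
    (ψ : TriangleGroup p q → ℤ)
    (hψ : ∀ γ₁ γ₂ : TriangleGroup p q,
      (ψ (γ₁ * γ₂) : ℝ) = ψ γ₁ + ψ γ₂ + 2 * p * q * W (γ₁ : SL2R) (γ₂ : SL2R))
    (hneg : ∀ γ₁ γ₂ : TriangleGroup p q, (γ₁ : SL2R) = -(γ₂ : SL2R) →
      Psi p q ψ γ₁ = Psi p q ψ γ₂)
    (hconj : ∀ γ g : TriangleGroup p q, Psi p q ψ (g⁻¹ * γ * g) = Psi p q ψ γ)
    (r : ℕ) (hr : 1 ≤ r) (n m : ℕ → ℤ)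
    (hn : ∀ j < r, 0 < n j ∧ n j < p) (hm : ∀ j < r, 0 < m j ∧ m j < q)
    (γ : TriangleGroup p q)
    (hγ : ∃ (g P : TriangleGroup p q) (ε : ℝ), (ε = 1 ∨ ε = -1) ∧
      ((P : SL2R) : Matrix (Fin 2) (Fin 2) ℝ) =
        ε • ((((List.range r).map fun j => Sp p ^ n j * Uq q ^ m j).prod : SL2R) :
          Matrix (Fin 2) (Fin 2) ℝ) ∧
      γ = g⁻¹ * P * g) :
    Psi p q ψ γ = ∑ j ∈ Finset.range r, ((p * q : ℝ) - q * n j - p * m j) := by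
  have hq : 2 ≤ q := by omega
  have hp0 : (p : ℝ) ≠ 0 := by positivity
  have hq0 : (q : ℝ) ≠ 0 := by positivity
  obtain ⟨s, hs⟩ : ∃ s : TriangleGroup p q, (s : SL2R) = Sp p :=
    ⟨⟨Sp p, Subgroup.subset_closure (by simp)⟩, rfl⟩
  obtain ⟨u, hu⟩ : ∃ u : TriangleGroup p q, (u : SL2R) = Uq q :=
    ⟨⟨Uq q, Subgroup.subset_closure (by simp)⟩, rfl⟩
  obtain ⟨z, hz⟩ : ∃ z : TriangleGroup p q, (z : SL2R) = -1 :=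
    ⟨s ^ p, by rw [SubmonoidClass.coe_pow, hs, Sp_pow_p p hp]⟩
  obtain ⟨hs1, hs2⟩ := psi_pow hψ p hp s (by rw [hs, Sp_pow_p p hp])
    (by rw [hs]; exact sgn_Sp_pow p hp)
  obtain ⟨hu1, hu2⟩ := psi_pow hψ q hq u (by rw [hu, Uq_pow_p q hq])
    (by rw [hu]; exact sgn_Uq_pow q hq)
  have hsv : (ψ s : ℝ) = -q := by
    apply mul_left_cancel₀ hp0; linarith
  have huv : (ψ u : ℝ) = -p := by
    apply mul_left_cancel₀ hq0; linarith
  -- a single block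
  have block : ∀ a b : ℤ, 0 < a ∧ a < p → 0 < b ∧ b < q →
      ∃ N : TriangleGroup p q, (N : SL2R) = -(Sp p ^ a * Uq q ^ b) ∧ GoodM N ∧
        (ψ N : ℝ) = p * q - q * a - p * b := by
    intro a b ha hb
    obtain ⟨a, rfl⟩ := Int.eq_ofNat_of_zero_le ha.1.le
    obtain ⟨b, rfl⟩ := Int.eq_ofNat_of_zero_le hb.1.le
    have a0 : 0 < a := by omega
    have a1 : a < p := by omega
    have b0 : 0 < b := by omega
    have b1 : b < q := by omega
    have hN : ((z * (s ^ a * u ^ b) : TriangleGroup p q) : SL2R) = -(Sp p ^ a * Uq q ^ b) := by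
      simp [hz, hs, hu]
    have hg := good_block p q hp hq a b a0 a1 b0 b1
    refine ⟨z * (s ^ a * u ^ b), by simpa using hN, by rw [hN]; exact hg, ?_⟩
    have hc : ((s ^ a * u ^ b : TriangleGroup p q) : SL2R) = Sp p ^ a * Uq q ^ b := by
      simp [hs, hu]
    rw [← Psi_good _ (by rw [hN]; exact hg), hneg _ (s ^ a * u ^ b) (by rw [hN, hc]), Psi,
      hψ, hs2 a a1, hu2 b b1, hc, SubmonoidClass.coe_pow, SubmonoidClass.coe_pow, hs, hu, W,
      sgn_Sp_pow p hp a a0 a1, sgn_Uq_pow q hq b b0 b1, hsv, huv]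
    obtain ⟨g1, g2, g3, g4⟩ := hg
    simp only [Matrix.SpecialLinearGroup.coe_neg, Matrix.neg_apply] at g1 g2 g3 g4
    have ht : Matrix.trace ((Sp p ^ a * Uq q ^ b : SL2R) : Matrix (Fin 2) (Fin 2) ℝ) < 0 := by
      rw [Matrix.trace_fin_two]
      linarith
    rw [Real.sign_of_neg ht]
    have g4' : 0 ≤ (Sp p ^ a * Uq q ^ b : SL2R).1 1 0 := by linarith
    rcases g4'.eq_or_lt with h | h
    · rw [sgn_zero_neg h.symm (by linarith)]
      push_cast
      ring
    · rw [sgn_of_pos h]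
      push_cast
      ring
  -- the whole product
  have prod : ∀ k ≤ r, ∃ (N : TriangleGroup p q) (δ : ℝ), (δ = 1 ∨ δ = -1) ∧
      ((N : SL2R) : Matrix (Fin 2) (Fin 2) ℝ) =
        δ • ((((List.range k).map fun j => Sp p ^ n j * Uq q ^ m j).prod : SL2R) :
          Matrix (Fin 2) (Fin 2) ℝ) ∧ GoodM N ∧
      (ψ N : ℝ) = ∑ j ∈ Finset.range k, ((p * q : ℝ) - q * n j - p * m j) := by
    intro k
    induction k with
    | zero =>
      intro _
      exact ⟨1, 1, Or.inl rfl, by simp, GoodM.one, by simp [psi_one hψ]⟩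
    | succ k ih =>
      intro hk
      obtain ⟨N, δ, hδ, hN, hG, hv⟩ := ih (by omega)
      obtain ⟨B, hB, hBG, hBv⟩ := block (n k) (m k) (hn k (by omega)) (hm k (by omega))
      refine ⟨N * B, -δ, ?_, ?_, hG.mul hBG, ?_⟩
      · rcases hδ with h | h <;> simp [h]
      · rw [List.range_succ, List.map_append, List.prod_append, Subgroup.coe_mul,
          Matrix.SpecialLinearGroup.coe_mul, hN, hB, Matrix.SpecialLinearGroup.coe_neg,
          Matrix.SpecialLinearGroup.coe_mul (List.prod _)]
        simp only [List.map_cons, List.map_nil, List.prod_cons, List.prod_nil, mul_one]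
        rw [Matrix.mul_neg, neg_smul, Matrix.smul_mul]
      · rw [hψ, hG.W hBG, hv, hBv, Finset.sum_range_succ]
        ring
  obtain ⟨g, P, ε, hε, hP, rfl⟩ := hγ
  obtain ⟨N, δ, hδ, hN, hG, hv⟩ := prod r le_rfl
  rw [hconj, ← hv, ← Psi_good N hG]
  have hPN : P = N ∨ (P : SL2R) = -(N : SL2R) := by
    rcases hε with h | h <;> rcases hδ with h' | h' <;> subst h <;> subst h'
    · left; exact Subtype.ext (Subtype.ext (by rw [hP, hN]))
    · right; exact Subtype.ext (by rw [Matrix.SpecialLinearGroup.coe_neg, hP, hN]; simp)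
    · right; exact Subtype.ext (by rw [Matrix.SpecialLinearGroup.coe_neg, hP, hN]; simp)
    · left; exact Subtype.ext (Subtype.ext (by rw [hP, hN]))
  rcases hPN with h | h
  · rw [h]
  · exact hneg _ _ h
end
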